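/- Let θ : ℤ²₀ → ℝ have finite support and be radially symmetric. Then for every probability measure μ on 𝕋² and every C¹ function φ : 𝕋² → ℝ, one has ∑_{k ∈ ℤ²₀} θ_k² (∫_{𝕋²} σ_k(x)·∇φ(x) μ(dx))² ≤ (1/2) ‖θ‖²_{ℓ²} ∫_{𝕋²} |∇φ(x)|² μ(dx); in particular the left-hand side is at most (1/2) ‖θ‖²_{ℓ²} ‖∇φ‖²_∞. -/

import Mathlib

open MeasureTheory Real Filter
open scoped Classical

noncomputable section

abbrev T2 : Type := AddCircle (1:ℝ) × AddCircle (1:ℝ)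

/-- cos(2π k·x) on the 2D torus. -/
def tCos (k : ℤ × ℤ) (x : T2) : ℝ := (fourier k.1 x.1 * fourier k.2 x.2).re

/-- sin(2π k·x) on the 2D torus. -/
def tSin (k : ℤ × ℤ) (x : T2) : ℝ := (fourier k.1 x.1 * fourier k.2 x.2).im

/-- The trigonometric basis functions e_k on the torus. -/
def eFun (k : ℤ × ℤ) (x : T2) : ℝ :=
  if k = 0 then 1
  else if 0 < k.1 ∨ (k.1 = 0 ∧ 0 < k.2) then Real.sqrt 2 * tCos k x
  else Real.sqrt 2 * tSin k x

/-- |k| for k ∈ ℤ². -/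
def knorm (k : ℤ × ℤ) : ℝ := Real.sqrt ((k.1:ℝ)^2 + (k.2:ℝ)^2)

/-- k⊥ = (k₂, -k₁). -/
def kperp (k : ℤ × ℤ) : Fin 2 → ℝ := ![(k.2:ℝ), -(k.1:ℝ)]

/-- The divergence-free vector fields σ_k(x) = (k⊥/|k|) e_k(x). -/
def sigmaV (k : ℤ × ℤ) (x : T2) : Fin 2 → ℝ := fun i => kperp k i / knorm k * eFun k x

/-- θ is radially symmetric: θ_k = θ_j whenever |k| = |j|. -/
def Radial (θ : ℤ × ℤ → ℝ) : Prop := ∀ k j : ℤ × ℤ, knorm k = knorm j → θ k = θ j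

/-- Projection of the plane onto the torus. -/
def projE (v : EuclideanSpace ℝ (Fin 2)) : T2 := ((v 0 : AddCircle (1:ℝ)), (v 1 : AddCircle (1:ℝ)))

/-- Partial derivative of a function on the torus in the first coordinate direction. -/
def pd1 (f : T2 → ℝ) (x : T2) : ℝ := deriv (fun t : ℝ => f (x.1 + (t : AddCircle (1:ℝ)), x.2)) 0

/-- Partial derivative of a function on the torus in the second coordinate direction. -/
def pd2 (f : T2 → ℝ) (x : T2) : ℝ := deriv (fun t : ℝ => f (x.1, x.2 + (t : AddCircle (1:ℝ)))) 0

/-- The gradient of a function on the torus. -/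
def tgrad (f : T2 → ℝ) (x : T2) : Fin 2 → ℝ := ![pd1 f x, pd2 f x]

theorem continuous_projE : Continuous projE := by
  unfold projE
  have h (i : Fin 2) : Continuous fun v : EuclideanSpace ℝ (Fin 2) => (v i : AddCircle (1:ℝ)) :=
    (AddCircle.continuous_mk' (1:ℝ)).comp (by fun_prop)
  exact (h 0).prodMk (h 1)

theorem isQuotientMap_projE : Topology.IsQuotientMap projE := by
  have hq : Topology.IsQuotientMap
      (Prod.map ((↑) : ℝ → AddCircle (1:ℝ)) ((↑) : ℝ → AddCircle (1:ℝ))) :=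
    ((QuotientAddGroup.isOpenQuotientMap_mk).prodMap
      (QuotientAddGroup.isOpenQuotientMap_mk)).isQuotientMap
  refine Topology.IsQuotientMap.of_comp
    (f := fun p : ℝ × ℝ => (!₂[p.1, p.2] : EuclideanSpace ℝ (Fin 2))) ?_ continuous_projE ?_
  · fun_prop
  · exact hq

section Gradient

variable {φ : T2 → ℝ}

theorem pd1_projE (hφ : ContDiff ℝ 1 (fun v => φ (projE v))) (v : EuclideanSpace ℝ (Fin 2)) :
    pd1 φ (projE v) = fderiv ℝ (fun v => φ (projE v)) v !₂[1, 0] := by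
  have hd := (hφ.differentiable one_ne_zero v).lineDeriv_eq_fderiv (v := !₂[1, 0])
  rw [← hd]
  simp [pd1, lineDeriv, projE]

theorem pd2_projE (hφ : ContDiff ℝ 1 (fun v => φ (projE v))) (v : EuclideanSpace ℝ (Fin 2)) :
    pd2 φ (projE v) = fderiv ℝ (fun v => φ (projE v)) v !₂[0, 1] := by
  have hd := (hφ.differentiable one_ne_zero v).lineDeriv_eq_fderiv (v := !₂[0, 1])
  rw [← hd]
  simp [pd2, lineDeriv, projE]

theorem continuous_tgrad (hφ : ContDiff ℝ 1 (fun v => φ (projE v))) (i : Fin 2) :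
    Continuous fun x => tgrad φ x i := by
  have hc := hφ.continuous_fderiv one_ne_zero
  rw [isQuotientMap_projE.continuous_iff]
  fin_cases i
  · refine (hc.clm_apply (continuous_const (y := !₂[1, 0]))).congr fun v => ?_
    simp [tgrad, pd1_projE hφ]
  · refine (hc.clm_apply (continuous_const (y := !₂[0, 1]))).congr fun v => ?_
    simp [tgrad, pd2_projE hφ]

end Gradient

theorem continuous_eFun (k : ℤ × ℤ) : Continuous (eFun k) := by
  unfold eFun tCos tSin
  split_ifs <;> fun_prop

theorem tCos_neg (k : ℤ × ℤ) (x : T2) : tCos (-k) x = tCos k x := by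
  simp only [tCos, Prod.fst_neg, Prod.snd_neg, fourier_neg, ← map_mul, Complex.conj_re]

theorem tSin_neg (k : ℤ × ℤ) (x : T2) : tSin (-k) x = -tSin k x := by
  simp only [tSin, Prod.fst_neg, Prod.snd_neg, fourier_neg, ← map_mul, Complex.conj_im]

theorem tCos_sq_add_tSin_sq (k : ℤ × ℤ) (x : T2) : tCos k x ^ 2 + tSin k x ^ 2 = 1 := by
  have h : ‖fourier k.1 x.1 * fourier k.2 x.2‖ = 1 := by
    rw [norm_mul, fourier_apply, fourier_apply, Circle.norm_coe, Circle.norm_coe, one_mul]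
  rw [tCos, tSin, sq, sq, ← Complex.normSq_apply, Complex.normSq_eq_norm_sq, h, one_pow]

theorem eFun_sq_add_eFun_neg_sq {k : ℤ × ℤ} (hk : k ≠ 0) (x : T2) :
    eFun k x ^ 2 + eFun (-k) x ^ 2 = 2 := by
  have h2 : √(2:ℝ) ^ 2 = 2 := Real.sq_sqrt (by norm_num)
  have hcs := tCos_sq_add_tSin_sq k x
  have hk' : ¬ (k.1 = 0 ∧ k.2 = 0) := fun h => hk (Prod.ext h.1 h.2)
  simp only [eFun, hk, neg_eq_zero, if_false, tCos_neg, tSin_neg, Prod.fst_neg, Prod.snd_neg]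
  split_ifs with h h' h'
  · omega
  · linear_combination (tCos k x ^ 2 + tSin k x ^ 2) * h2 + 2 * hcs
  · linear_combination (tCos k x ^ 2 + tSin k x ^ 2) * h2 + 2 * hcs
  · omega

theorem knorm_neg (k : ℤ × ℤ) : knorm (-k) = knorm k := by
  simp [knorm]

theorem knorm_sq (k : ℤ × ℤ) : knorm k ^ 2 = (k.1:ℝ) ^ 2 + (k.2:ℝ) ^ 2 :=
  Real.sq_sqrt (by positivity)

theorem knorm_ne_zero {k : ℤ × ℤ} (hk : k ≠ 0) : knorm k ≠ 0 := by
  intro h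
  have hs := knorm_sq k
  rw [h] at hs
  refine hk (Prod.ext ?_ ?_)
  · exact_mod_cast (by nlinarith [sq_nonneg (k.1:ℝ), sq_nonneg (k.2:ℝ)] : (k.1:ℝ) = 0)
  · exact_mod_cast (by nlinarith [sq_nonneg (k.1:ℝ), sq_nonneg (k.2:ℝ)] : (k.2:ℝ) = 0)

/-- Rotation of `ℤ²` by a quarter turn. -/
def quarterTurn : ℤ × ℤ ≃ ℤ × ℤ where
  toFun k := (k.2, -k.1)
  invFun k := (-k.2, k.1)
  left_inv k := by simp
  right_inv k := by simp

theorem knorm_quarterTurn (k : ℤ × ℤ) : knorm (quarterTurn k) = knorm k := by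
  simp [knorm, quarterTurn, add_comm]

theorem finsum_eq_half_finsum_of_add_comp_equiv {α : Type*} {f g : α → ℝ} (e : α ≃ α)
    (hf : (Function.support f).Finite) (h : ∀ a, f a + f (e a) = g a) :
    ∑ᶠ a, f a = (1 / 2 : ℝ) * ∑ᶠ a, g a := by
  have hfe : (Function.support fun a => f (e a)).Finite :=
    hf.preimage (f := e) e.injective.injOn
  have hsum : ∑ᶠ a, g a = ∑ᶠ a, f a + ∑ᶠ a, f (e a) := by
    rw [← finsum_add_distrib hf hfe]
    exact finsum_congr fun a => (h a).symm
  rw [hsum, finsum_comp_equiv e]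
  ring

theorem finsum_sq_mul_sigmaV_sq {θ : ℤ × ℤ → ℝ} (hfin : (Function.support θ).Finite)
    (hzero : θ 0 = 0) (hrad : Radial θ) (x : T2) (v : Fin 2 → ℝ) :
    ∑ᶠ k, θ k ^ 2 * (∑ i, sigmaV k x i * v i) ^ 2
      = (1 / 2 : ℝ) * (∑ᶠ k, θ k ^ 2) * ∑ i, v i ^ 2 := by
  have hsupp (c : ℤ × ℤ → ℝ) : (Function.support fun k => θ k ^ 2 * c k).Finite :=
    hfin.subset fun k hk h => hk (by simp [h])
  have hpair : ∑ᶠ k, θ k ^ 2 * (∑ i, sigmaV k x i * v i) ^ 2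
      = (1 / 2 : ℝ) * ∑ᶠ k, θ k ^ 2 * (2 * (∑ i, kperp k i / knorm k * v i) ^ 2) := by
    refine finsum_eq_half_finsum_of_add_comp_equiv (Equiv.neg _) (hsupp _) fun k => ?_
    rcases eq_or_ne k 0 with rfl | hk
    · simp [hzero]
    · have he := eFun_sq_add_eFun_neg_sq hk x
      have hθ : θ (-k) = θ k := hrad _ _ (knorm_neg k)
      simp only [Equiv.neg_apply, hθ, sigmaV, kperp, knorm_neg, Fin.sum_univ_two,
        Matrix.cons_val_zero, Matrix.cons_val_one, Prod.fst_neg, Prod.snd_neg, Int.cast_neg]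
      linear_combination
        θ k ^ 2 * ((k.2:ℝ) / knorm k * v 0 + -(k.1:ℝ) / knorm k * v 1) ^ 2 * he
  have hturn : ∑ᶠ k, θ k ^ 2 * (2 * (∑ i, kperp k i / knorm k * v i) ^ 2)
      = (1 / 2 : ℝ) * ∑ᶠ k, θ k ^ 2 * (2 * ∑ i, v i ^ 2) := by
    refine finsum_eq_half_finsum_of_add_comp_equiv quarterTurn (hsupp _) fun k => ?_
    have hθ : θ (quarterTurn k) = θ k := hrad _ _ (knorm_quarterTurn k)
    rcases eq_or_ne k 0 with rfl | hk
    · simp [hθ, hzero]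
    · have hn := knorm_ne_zero hk
      have hs := knorm_sq k
      simp only [hθ, knorm_quarterTurn]
      simp only [kperp, quarterTurn, Fin.sum_univ_two, Equiv.coe_fn_mk,
        Matrix.cons_val_zero, Matrix.cons_val_one, Int.cast_neg]
      field_simp
      linear_combination (-θ k ^ 2 * (v 0 ^ 2 + v 1 ^ 2)) * hs
  rw [hpair, hturn, ← finsum_mul]
  ring

theorem sq_integral_le_integral_sq {Ω : Type*} [MeasurableSpace Ω] {μ : Measure Ω}
    [IsProbabilityMeasure μ] {f : Ω → ℝ} (hf : Integrable f μ)
    (hf2 : Integrable (fun x => f x ^ 2) μ) : (∫ x, f x ∂μ) ^ 2 ≤ ∫ x, f x ^ 2 ∂μ :=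
  (even_two.convexOn_pow (𝕜 := ℝ)).map_integral_le (by fun_prop) isClosed_univ (by simp) hf hf2

/-- For finitely supported radially symmetric `θ`, any probability measure `μ`
on `𝕋²` and any C¹ function `φ`,
`∑_k θ_k² (∫ σ_k·∇φ dμ)² ≤ (1/2)‖θ‖²_{ℓ²} ∫ |∇φ|² dμ ≤ (1/2)‖θ‖²_{ℓ²} ‖∇φ‖²_∞`. -/
theorem statement5 (θ : ℤ × ℤ → ℝ) (hfin : (Function.support θ).Finite)
    (hzero : θ 0 = 0) (hrad : Radial θ)
    (μ : Measure T2) [IsProbabilityMeasure μ]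
    (φ : T2 → ℝ) (hφ : ContDiff ℝ 1 (fun v => φ (projE v))) :
    (∑ᶠ k : ℤ × ℤ, (θ k) ^ 2 * (∫ x, (∑ i, sigmaV k x i * tgrad φ x i) ∂μ) ^ 2
      ≤ (1 / 2 : ℝ) * (∑ᶠ k : ℤ × ℤ, (θ k) ^ 2) * ∫ x, (∑ i, (tgrad φ x i) ^ 2) ∂μ) ∧
    (∑ᶠ k : ℤ × ℤ, (θ k) ^ 2 * (∫ x, (∑ i, sigmaV k x i * tgrad φ x i) ∂μ) ^ 2
      ≤ (1 / 2 : ℝ) * (∑ᶠ k : ℤ × ℤ, (θ k) ^ 2) * ⨆ x : T2, ∑ i, (tgrad φ x i) ^ 2) := by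
  have hint {f : T2 → ℝ} (hf : Continuous f) : Integrable f μ :=
    hf.integrable_of_hasCompactSupport (HasCompactSupport.of_compactSpace f)
  have hgrad := continuous_tgrad hφ
  have hσ (k : ℤ × ℤ) : Continuous fun x => ∑ i, sigmaV k x i * tgrad φ x i :=
    continuous_finsetSum _ fun i _ => (continuous_const.mul (continuous_eFun k)).mul (hgrad i)
  have hsq : Continuous fun x => ∑ i, tgrad φ x i ^ 2 := by fun_prop
  have hsub (c : ℤ × ℤ → ℝ) :
      (Function.support fun k => θ k ^ 2 * c k) ⊆ hfin.toFinset := fun k hk => by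
    simp only [Set.Finite.coe_toFinset]
    exact fun h => hk (by simp [h])
  have hmain : ∑ᶠ k : ℤ × ℤ, (θ k) ^ 2 * (∫ x, (∑ i, sigmaV k x i * tgrad φ x i) ∂μ) ^ 2
      ≤ (1 / 2 : ℝ) * (∑ᶠ k : ℤ × ℤ, (θ k) ^ 2) * ∫ x, (∑ i, (tgrad φ x i) ^ 2) ∂μ := by
    rw [← integral_const_mul]
    simp_rw [← fun x => finsum_sq_mul_sigmaV_sq hfin hzero hrad x (tgrad φ x)]
    simp_rw [finsum_eq_sum_of_support_subset _ (hsub _)]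
    rw [integral_finsetSum]
    swap
    · exact fun k _ => hint (continuous_const.mul ((hσ k).pow 2))
    refine Finset.sum_le_sum fun k _ => ?_
    rw [integral_const_mul]
    gcongr
    exact sq_integral_le_integral_sq (hint (hσ k)) (hint ((hσ k).pow 2))
  refine ⟨hmain, hmain.trans ?_⟩
  have hnonneg : 0 ≤ ∑ᶠ k : ℤ × ℤ, (θ k) ^ 2 := finsum_nonneg fun k => sq_nonneg _
  gcongr
  have hbdd : BddAbove (Set.range fun x : T2 => ∑ i, tgrad φ x i ^ 2) :=
    (isCompact_range hsq).bddAbove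
  calc ∫ x, (∑ i, (tgrad φ x i) ^ 2) ∂μ
      ≤ ∫ _, (⨆ x : T2, ∑ i, (tgrad φ x i) ^ 2) ∂μ :=
        integral_mono (hint hsq) (integrable_const _) fun x => le_ciSup hbdd x
    _ = ⨆ x : T2, ∑ i, (tgrad φ x i) ^ 2 := by simp
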